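/- Let X and Y be cocompact G-trees which define the same partition of G into elliptic and hyperbolic elements. Suppose that Y is proper and that every vertex stabilizer of X fixes a vertex of Y. Then X and Y have the same elliptic subgroups. -/

import Mathlib

universe u

/-- A `G`-tree: a simplicial tree together with an action of `G` by graph
automorphisms without inversions. -/
structure GTree (G : Type u) [Group G] : Type (u + 1) where
  V : Type u
  graph : SimpleGraph V
  isTree : graph.IsTree
  smul : G → V → V
  smul_one : ∀ x, smul 1 x = x
  smul_mul : ∀ γ δ x, smul (γ * δ) x = smul γ (smul δ x)
  smul_adj : ∀ (γ : G) ⦃x y : V⦄, graph.Adj x y → graph.Adj (smul γ x) (smul γ y)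
  no_inversions : ∀ (γ : G) (x y : V), graph.Adj x y → ¬(smul γ x = y ∧ smul γ y = x)

namespace GTree

variable {G : Type u} [Group G]

/-- Oriented edges of a `G`-tree. -/
def Edge (X : GTree G) : Type u := { p : X.V × X.V // X.graph.Adj p.1 p.2 }

/-- Initial vertex `∂₀ e` of an oriented edge. -/
def d0 {X : GTree G} (e : X.Edge) : X.V := e.1.1

/-- Terminal vertex `∂₁ e` of an oriented edge. -/
def d1 {X : GTree G} (e : X.Edge) : X.V := e.1.2

/-- The underlying geometric (unoriented) edge. -/
def esym {X : GTree G} (e : X.Edge) : Sym2 X.V := s(e.1.1, e.1.2)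

/-- Action of `G` on oriented edges. -/
def edgeSmul {X : GTree G} (γ : G) (e : X.Edge) : X.Edge :=
  ⟨(X.smul γ e.1.1, X.smul γ e.1.2), X.smul_adj γ e.2⟩

/-- Vertex stabilizer `G_x`. -/
def stab (X : GTree G) (x : X.V) : Subgroup G where
  carrier := { γ | X.smul γ x = x }
  one_mem' := X.smul_one x
  mul_mem' := by
    intro a b ha hb
    simp only [Set.mem_setOf_eq] at *
    rw [X.smul_mul, hb, ha]
  inv_mem' := by
    intro a ha
    simp only [Set.mem_setOf_eq] at *
    conv_lhs => rw [← ha]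
    rw [← X.smul_mul, inv_mul_cancel, X.smul_one]

/-- Edge stabilizer `G_e`: the elements fixing both endpoints (since the action
is without inversions, these are exactly the elements fixing the edge). -/
def edgeStab (X : GTree G) (e : X.Edge) : Subgroup G :=
  X.stab (d0 e) ⊓ X.stab (d1 e)

/-- An element of `G` is elliptic if it fixes a vertex. -/
def Elliptic (X : GTree G) (γ : G) : Prop := ∃ x, X.smul γ x = x

/-- A subgroup of `G` is elliptic if it fixes a vertex. -/
def FixesVertex (X : GTree G) (H : Subgroup G) : Prop := ∃ x, ∀ γ ∈ H, X.smul γ x = x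

/-- Two `G`-trees have the same elliptic subgroups. -/
def SameEllipticSubgroups (X Y : GTree G) : Prop :=
  ∀ H : Subgroup G, X.FixesVertex H ↔ Y.FixesVertex H

/-- The length function `ℓ_X(γ)`: the minimal vertex displacement. -/
noncomputable def transLen (X : GTree G) (γ : G) : ℕ :=
  sInf (Set.range fun x => X.graph.dist x (X.smul γ x))

/-- Cocompact: the quotient graph `G\X` is finite, i.e. there are finitely
many orbits of vertices and of edges. -/
def Cocompact (X : GTree G) : Prop :=
  Finite (Quot fun x y : X.V => ∃ γ, X.smul γ x = y) ∧
    Finite (Quot fun e f : X.Edge => ∃ γ, edgeSmul γ e = f)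

/-- Reduced: whenever `G_e = G_{∂₀ e}`, the endpoints of `e` are in the same
`G`-orbit. -/
def Reduced (X : GTree G) : Prop :=
  ∀ e : X.Edge, X.edgeStab e = X.stab (d0 e) → ∃ γ, X.smul γ (d0 e) = d1 e

/-- A nonempty `G`-invariant subtree (a nonempty invariant set of vertices that
is connected in the induced graph). -/
def IsInvariantSubtree (X : GTree G) (S : Set X.V) : Prop :=
  S.Nonempty ∧ (∀ γ, ∀ x ∈ S, X.smul γ x ∈ S) ∧
    ∀ x ∈ S, ∀ y ∈ S, ∃ p : X.graph.Walk x y, ∀ v ∈ p.support, v ∈ S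

/-- Minimal: there is no proper nonempty invariant subtree. -/
def Minimal (X : GTree G) : Prop :=
  ∀ S : Set X.V, X.IsInvariantSubtree S → S = Set.univ

/-- Strongly slide-free: minimal, and for all edges `e`, `f` with
`∂₀ e = ∂₀ f`, the inclusion `G_e ⊆ G_f` implies `f ∈ G e`. -/
def StronglySlideFree (X : GTree G) : Prop :=
  X.Minimal ∧ ∀ e f : X.Edge, d0 e = d0 f → X.edgeStab e ≤ X.edgeStab f →
    ∃ γ, edgeSmul γ e = f

/-- Proper: `G_e ⊊ G_{∂₀ e}` for every edge `e`. -/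
def Proper (X : GTree G) : Prop := ∀ e : X.Edge, X.edgeStab e < X.stab (d0 e)

/-- Locally finite: every vertex has finite valence. -/
def LocallyFinite (X : GTree G) : Prop := ∀ x : X.V, (X.graph.neighborSet x).Finite

/-- `φ` is an isomorphism of `G`-trees: an equivariant graph isomorphism. -/
def IsGIso (X Y : GTree G) (φ : X.V → Y.V) : Prop :=
  Function.Bijective φ ∧ (∀ x y, X.graph.Adj x y ↔ Y.graph.Adj (φ x) (φ y)) ∧
    ∀ γ x, φ (X.smul γ x) = Y.smul γ (φ x)

/-- `φ : X → Y` is the collapse move performed at (the orbit of) the edge `e`: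
`G_e = G_{∂₀ e}`, the endpoints of `e` lie in different `G`-orbits, and `Y` is
the equivariant quotient of `X` identifying `∂₀(γ e)` with `∂₁(γ e)` for all
`γ ∈ G`. -/
def IsCollapse (X Y : GTree G) (φ : X.V → Y.V) (e : X.Edge) : Prop :=
  X.edgeStab e = X.stab (d0 e) ∧
  (∀ γ : G, X.smul γ (d0 e) ≠ d1 e) ∧
  Function.Surjective φ ∧
  (∀ γ x, φ (X.smul γ x) = Y.smul γ (φ x)) ∧
  (∀ u v : X.V, φ u = φ v ↔
    Relation.EqvGen (fun a b => ∃ γ : G, a = X.smul γ (d0 e) ∧ b = X.smul γ (d1 e)) u v) ∧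
  (∀ a b : Y.V, a ≠ b → (Y.graph.Adj a b ↔ ∃ u v, X.graph.Adj u v ∧ φ u = a ∧ φ v = b))

/-- `Y` is obtained from `X` by a collapse move. -/
def Collapse (X Y : GTree G) : Prop := ∃ (φ : X.V → Y.V) (e : X.Edge), IsCollapse X Y φ e

/-- Elementary deformation: a finite composition of collapse moves and their
inverses (expansion moves). -/
def ElemDeformation : GTree G → GTree G → Prop := Relation.EqvGen Collapse

end GTree

namespace SimpleGraph

variable {V : Type*} {T : SimpleGraph V}

/-- In a connected graph a geodesic has a vertex at every admissible distance from its start. -/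
lemma Connected.exists_dist_eq (hT : T.Connected) (x y : V) {k : ℕ} (hk : k ≤ T.dist x y) :
    ∃ z, T.dist x z = k ∧ T.dist x z + T.dist z y = T.dist x y := by
  obtain ⟨p, hp⟩ := hT.exists_walk_length_eq_dist x y
  have h₁ := dist_le (p.take k)
  have h₂ := dist_le (p.drop k)
  have h₃ := hT.dist_triangle (u := x) (v := p.getVert k) (w := y)
  have h₄ : (p.take k).length = min k p.length := by simp
  have h₅ : (p.drop k).length = p.length - k := by simp
  exact ⟨p.getVert k, by omega, by omega⟩

lemma Walk.dist_add_dist_of_mem_support (hT : T.Connected) {x y z : V} {p : T.Walk x y}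
    (hp : p.length = T.dist x y) (hz : z ∈ p.support) :
    T.dist x z + T.dist z y = T.dist x y := by
  classical
  have h₁ := dist_le (p.takeUntil z hz)
  have h₂ := dist_le (p.dropUntil z hz)
  have h₃ := hT.dist_triangle (u := x) (v := z) (w := y)
  have h₄ := congrArg Walk.length (p.take_spec hz)
  rw [Walk.length_append] at h₄
  omega

lemma IsTree.length_eq_dist (hT : T.IsTree) {x y : V} {p : T.Walk x y} (hp : p.IsPath) :
    p.length = T.dist x y := by
  obtain ⟨q, hq, hq'⟩ := hT.connected.exists_path_of_dist x y
  have := congrArg Subtype.val ((hT.isAcyclic.subsingleton_path x y).elim ⟨p, hp⟩ ⟨q, hq⟩)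
  rw [← hq', show p = q from this]

/-- In a tree a vertex of a geodesic is determined by its distance to the start. -/
lemma IsTree.eq_of_dist_eq (hT : T.IsTree) {x y z z' : V}
    (hz : T.dist x z + T.dist z y = T.dist x y) (hz' : T.dist x z' + T.dist z' y = T.dist x y)
    (h : T.dist x z = T.dist x z') : z = z' := by
  obtain ⟨p₁, h₁⟩ := hT.connected.exists_walk_length_eq_dist x z
  obtain ⟨p₂, h₂⟩ := hT.connected.exists_walk_length_eq_dist z y
  obtain ⟨q₁, k₁⟩ := hT.connected.exists_walk_length_eq_dist x z'
  obtain ⟨q₂, k₂⟩ := hT.connected.exists_walk_length_eq_dist z' y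
  have hp : (p₁.append p₂).IsPath :=
    Walk.isPath_of_length_eq_dist _ (by rw [Walk.length_append]; omega)
  have hq : (q₁.append q₂).IsPath :=
    Walk.isPath_of_length_eq_dist _ (by rw [Walk.length_append]; omega)
  have e : p₁.append p₂ = q₁.append q₂ :=
    congrArg Subtype.val ((hT.isAcyclic.subsingleton_path x y).elim ⟨_, hp⟩ ⟨_, hq⟩)
  have e' := congrArg (fun w => w.getVert (T.dist x z)) e
  simpa [Walk.getVert_append, h₁, k₁, h] using e'

/-- Any three vertices of a tree have a median. -/
lemma IsTree.exists_median (hT : T.IsTree) (x y z : V) :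
    ∃ m, T.dist x m + T.dist m y = T.dist x y ∧ T.dist x m + T.dist m z = T.dist x z ∧
      T.dist y m + T.dist m z = T.dist y z := by
  classical
  have key : ∃ m, T.dist x m + T.dist m y = T.dist x y ∧
      ∀ v, T.dist x v + T.dist v y = T.dist x y → T.dist m z ≤ T.dist v z := by
    have hne : ({v | T.dist x v + T.dist v y = T.dist x y} : Set V).Nonempty := ⟨x, by simp⟩
    refine ⟨Function.argminOn (fun v => T.dist v z) _ hne,
      Function.argminOn_mem (fun v => T.dist v z) _ hne,
      fun v hv => Function.argminOn_le (fun v => T.dist v z) _ hv⟩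
  obtain ⟨m, hm, hmin⟩ := key
  have aux : ∀ u, (∀ v, T.dist u v + T.dist v m = T.dist u m →
      T.dist x v + T.dist v y = T.dist x y) → T.dist u m + T.dist m z = T.dist u z := by
    intro u hu
    obtain ⟨p, hp⟩ := hT.connected.exists_walk_length_eq_dist u m
    obtain ⟨q, hq⟩ := hT.connected.exists_walk_length_eq_dist m z
    have hpath : (p.append q).IsPath := by
      have hqs := (q.isPath_of_length_eq_dist hq).support_nodup
      rw [← Walk.cons_tail_support, List.nodup_cons] at hqs
      rw [Walk.isPath_def, Walk.support_append, List.nodup_append]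
      refine ⟨(p.isPath_of_length_eq_dist hp).support_nodup, hqs.2, ?_⟩
      rintro v hv _ hv' rfl
      have h₁ := hmin v (hu v (Walk.dist_add_dist_of_mem_support hT.connected hp hv))
      have h₂ := Walk.dist_add_dist_of_mem_support hT.connected hq (List.mem_of_mem_tail hv')
      have h₃ : m = v := hT.connected.dist_eq_zero_iff.1 (by omega)
      exact hqs.1 (h₃ ▸ hv')
    have := hT.length_eq_dist hpath
    rw [Walk.length_append] at this
    omega
  have tri := fun a b c => hT.connected.dist_triangle (u := a) (v := b) (w := c)
  refine ⟨m, hm, aux x fun v hv => ?_, aux y fun v hv => ?_⟩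
  · have := tri x v y
    have := tri v m y
    omega
  · have := tri x v y
    have := tri x m v
    have := T.dist_comm (u := y) (v := m)
    have := T.dist_comm (u := y) (v := v)
    have := T.dist_comm (u := v) (v := m)
    omega

/-- Vertices of a geodesic in a tree are linearly ordered by their distance to the start. -/
lemma IsTree.dist_add_dist_of_le (hT : T.IsTree) {a q u v : V}
    (hu : T.dist a u + T.dist u q = T.dist a q) (hv : T.dist a v + T.dist v q = T.dist a q)
    (h : T.dist a u ≤ T.dist a v) : T.dist a u + T.dist u v = T.dist a v := by
  obtain ⟨w, hw, hw'⟩ := hT.connected.exists_dist_eq a v h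
  have tri := fun a b c => hT.connected.dist_triangle (u := a) (v := b) (w := c)
  have h₁ := tri a w q
  have h₂ := tri w v q
  obtain rfl := hT.eq_of_dist_eq (z := w) (z' := u) (by omega) hu hw
  exact hw'

end SimpleGraph

namespace GTree

variable {G : Type u} [Group G] (X : GTree G)

lemma smul_inv_smul (γ : G) (x : X.V) : X.smul γ⁻¹ (X.smul γ x) = x := by
  rw [← X.smul_mul, inv_mul_cancel, X.smul_one]

lemma smul_smul_inv (γ : G) (x : X.V) : X.smul γ (X.smul γ⁻¹ x) = x := by
  rw [← X.smul_mul, mul_inv_cancel, X.smul_one]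

/-- The action of a group element as a graph homomorphism. -/
def smulHom (γ : G) : X.graph →g X.graph where
  toFun := X.smul γ
  map_rel' h := X.smul_adj γ h

lemma dist_smul_le (γ : G) (x y : X.V) :
    X.graph.dist (X.smul γ x) (X.smul γ y) ≤ X.graph.dist x y := by
  obtain ⟨p, hp⟩ := X.isTree.connected.exists_walk_length_eq_dist x y
  rw [← hp, ← p.length_map (X.smulHom γ)]
  exact SimpleGraph.dist_le _

lemma dist_smul (γ : G) (x y : X.V) :
    X.graph.dist (X.smul γ x) (X.smul γ y) = X.graph.dist x y := by
  refine le_antisymm (X.dist_smul_le γ x y) ?_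
  simpa only [smul_inv_smul] using X.dist_smul_le γ⁻¹ (X.smul γ x) (X.smul γ y)

variable {X}

/-- An element fixing two vertices fixes the geodesic between them. -/
lemma smul_eq_of_dist_add_dist {γ : G} {u q v : X.V} (hu : X.smul γ u = u) (hq : X.smul γ q = q)
    (hv : X.graph.dist u v + X.graph.dist v q = X.graph.dist u q) : X.smul γ v = v := by
  have h₁ := X.dist_smul γ u v
  have h₂ := X.dist_smul γ v q
  rw [hu] at h₁
  rw [hq] at h₂
  exact X.isTree.eq_of_dist_eq (by omega) hv h₁

/-- An elliptic element `γ` fixes the midpoint of `[x, γ x]`, and this midpoint is the projection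
of `x` to the fixed subtree of `γ`. -/
lemma Elliptic.exists_midpoint {γ : G} (hγ : X.Elliptic γ) (x : X.V) :
    ∃ p, X.smul γ p = p ∧
      X.graph.dist x p + X.graph.dist p (X.smul γ x) = X.graph.dist x (X.smul γ x) ∧
      ∀ c, X.smul γ c = c → X.graph.dist x p + X.graph.dist p c = X.graph.dist x c := by
  have key : ∀ c, X.smul γ c = c → ∃ p, X.smul γ p = p ∧
      X.graph.dist x p + X.graph.dist p (X.smul γ x) = X.graph.dist x (X.smul γ x) ∧
      X.graph.dist x p + X.graph.dist p c = X.graph.dist x c := by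
    intro c hc
    obtain ⟨p, h₁, h₂, h₃⟩ := X.isTree.exists_median x (X.smul γ x) c
    refine ⟨p, ?_, h₁, h₂⟩
    have e₁ := X.dist_smul γ x c
    have e₂ := X.dist_smul γ x p
    have e₃ := X.dist_smul γ p c
    rw [hc] at e₁ e₃
    exact X.isTree.eq_of_dist_eq (x := X.smul γ x) (y := c) (by omega) h₃ (by omega)
  have half : ∀ p, X.smul γ p = p → X.graph.dist p (X.smul γ x) = X.graph.dist x p := by
    intro p hp
    have e := X.dist_smul γ x p
    rwa [hp, X.graph.dist_comm] at e
  obtain ⟨c, hc⟩ := hγ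
  obtain ⟨p, hp, hp₁, -⟩ := key c hc
  refine ⟨p, hp, hp₁, fun d hd => ?_⟩
  obtain ⟨p', hp', hp₁', hd'⟩ := key d hd
  have e₁ := half p hp
  have e₂ := half p' hp'
  obtain rfl := X.isTree.eq_of_dist_eq hp₁ hp₁' (by omega)
  exact hd'

/-- Serre's lemma: if `g`, `h` and `g h` are elliptic, then `g` and `h` have a common fixed
vertex. -/
lemma Elliptic.exists_common_fixed {g h : G} (hg : X.Elliptic g) (hh : X.Elliptic h)
    (hgh : X.Elliptic (g * h)) : ∃ q, X.smul g q = q ∧ X.smul h q = q := by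
  obtain ⟨q, hq⟩ := hh
  obtain ⟨p, hp, hp₁, -⟩ := hg.exists_midpoint q
  obtain ⟨p', hp', hp₁', -⟩ := hgh.exists_midpoint q
  have e : X.smul (g * h) q = X.smul g q := by rw [X.smul_mul, hq]
  have e₁ := X.dist_smul g q p
  have e₂ := X.dist_smul (g * h) q p'
  rw [hp, X.graph.dist_comm] at e₁
  rw [hp', X.graph.dist_comm, e] at e₂
  rw [e] at hp₁'
  obtain rfl := X.isTree.eq_of_dist_eq hp₁ hp₁' (by omega)
  refine ⟨p, hp, ?_⟩
  have e₃ := X.smul_inv_smul g (X.smul h p)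
  have e₄ := X.smul_inv_smul g p
  rw [← X.smul_mul g, hp'] at e₃
  rw [hp] at e₄
  exact e₃.symm.trans e₄

/-- A subgroup of elliptic elements that fixes no vertex fixes an end: there is a geodesic ray
such that every element of the subgroup fixes almost all of its vertices. -/
lemma exists_fixed_ray (H : Subgroup G) (hH : ∀ h ∈ H, X.Elliptic h) (hfix : ¬X.FixesVertex H) :
    ∃ x : ℕ → X.V, (∀ m n, m ≤ n → X.graph.dist (x m) (x n) = n - m) ∧
      ∀ h ∈ H, ∃ N, ∀ n, N ≤ n → X.smul h (x n) = x n := by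
  obtain ⟨a⟩ := X.isTree.connected.nonempty
  have hmid : ∀ h : H, ∃ p, X.smul h p = p ∧ ∀ c, X.smul h c = c →
      X.graph.dist a p + X.graph.dist p c = X.graph.dist a c := fun h => by
    obtain ⟨p, h₁, -, h₃⟩ := (hH h h.2).exists_midpoint a
    exact ⟨p, h₁, h₃⟩
  choose p hp hpc using hmid
  have tri := fun a b c => X.isTree.connected.dist_triangle (u := a) (v := b) (w := c)
  have hcomp : ∀ g h : H, X.graph.dist a (p g) ≤ X.graph.dist a (p h) →
      X.graph.dist a (p g) + X.graph.dist (p g) (p h) = X.graph.dist a (p h) ∧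
        X.smul g (p h) = p h := by
    intro g h hle
    obtain ⟨q, hq, hq'⟩ := (hH g g.2).exists_common_fixed (hH h h.2)
      (hH _ (H.mul_mem g.2 h.2))
    have h₁ := hpc g q hq
    have h₂ := hpc h q hq'
    have h₃ := X.isTree.dist_add_dist_of_le h₁ h₂ hle
    exact ⟨h₃, smul_eq_of_dist_add_dist (hp g) hq (by omega)⟩
  have hunb : ∀ n, ∃ h : H, n ≤ X.graph.dist a (p h) := by
    by_contra! hb
    obtain ⟨n, hn⟩ := hb
    have hfin : (Set.range fun h : H => X.graph.dist a (p h)).Finite :=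
      (Set.finite_lt_nat n).subset (by rintro _ ⟨h, rfl⟩; exact hn h)
    obtain ⟨_, ⟨h, rfl⟩, hmax⟩ := hfin.exists_maximal ⟨_, 1, rfl⟩
    refine hfix ⟨p h, fun g hg => (hcomp ⟨g, hg⟩ h ?_).2⟩
    by_contra! hlt
    exact absurd (hmax ⟨⟨g, hg⟩, rfl⟩ hlt.le) (by simpa using hlt)
  choose t ht using hunb
  choose x hx hx' using fun n => X.isTree.connected.exists_dist_eq a (p (t n)) (ht n)
  have hon : ∀ n (h : H), n ≤ X.graph.dist a (p h) →
      X.graph.dist a (x n) + X.graph.dist (x n) (p h) = X.graph.dist a (p h) := by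
    intro n h hle
    have h₁ := hx n
    have h₂ := hx' n
    rcases le_total (X.graph.dist a (p h)) (X.graph.dist a (p (t n))) with hl | hl
    · have h₃ := (hcomp h (t n) hl).1
      exact X.isTree.dist_add_dist_of_le h₂ h₃ (by omega)
    · have h₃ := (hcomp (t n) h hl).1
      have := tri a (x n) (p h)
      have := tri (x n) (p (t n)) (p h)
      omega
  refine ⟨x, fun m n hmn => ?_, fun h hh => ⟨X.graph.dist a (p ⟨h, hh⟩), fun n hn => ?_⟩⟩
  · have h₁ := X.isTree.dist_add_dist_of_le (hon m (t n) (hmn.trans (ht n))) (hx' n)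
      (by rw [hx, hx]; exact hmn)
    rw [hx, hx] at h₁
    omega
  · have h₁ := hx n
    have h₂ := hx' n
    have h₃ := hcomp ⟨h, hh⟩ (t n) (hn.trans (ht n))
    have h₄ := X.isTree.dist_add_dist_of_le h₃.1 h₂ (by omega)
    exact smul_eq_of_dist_add_dist (hp ⟨h, hh⟩) h₃.2 (by omega)

/-- If the vertex stabilizers of `X` are elliptic in `Y`, there is an equivariant map from the
vertices of `X` to the vertices of `Y`. -/
lemma exists_equivariant (X Y : GTree G)
    (hstab : ∀ x : X.V, ∃ y : Y.V, ∀ γ : G, X.smul γ x = x → Y.smul γ y = y) :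
    ∃ f : X.V → Y.V, ∀ γ x, f (X.smul γ x) = Y.smul γ (f x) := by
  choose c hc using hstab
  let s : Setoid X.V :=
    { r := fun x y => ∃ γ, X.smul γ x = y
      iseqv :=
        { refl := fun x => ⟨1, X.smul_one x⟩
          symm := by
            rintro x _ ⟨γ, rfl⟩
            exact ⟨γ⁻¹, X.smul_inv_smul γ x⟩
          trans := by
            rintro x _ _ ⟨γ, rfl⟩ ⟨δ, rfl⟩
            exact ⟨δ * γ, X.smul_mul δ γ x⟩ } }
  let r : X.V → X.V := fun x => (Quotient.mk s x).out
  have hr : ∀ x, ∃ γ, X.smul γ (r x) = x := fun x => Quotient.mk_out (s := s) x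
  choose k hk using hr
  have hr' : ∀ γ x, r (X.smul γ x) = r x := fun γ x =>
    congrArg Quotient.out (Quotient.sound (s := s) (s.symm ⟨γ, rfl⟩))
  refine ⟨fun x => Y.smul (k x) (c (r x)), fun γ x => ?_⟩
  have h₁ : X.smul ((γ * k x)⁻¹ * k (X.smul γ x)) (r x) = r x := by
    have := hk (X.smul γ x)
    rw [hr'] at this
    rw [X.smul_mul, this]
    have e : X.smul (γ * k x) (r x) = X.smul γ x := by rw [X.smul_mul, hk]
    rw [← e]
    exact X.smul_inv_smul _ _
  have h₂ := hc _ _ h₁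
  rw [Y.smul_mul] at h₂
  have h₃ := congrArg (Y.smul (γ * k x)) h₂
  rw [Y.smul_smul_inv, Y.smul_mul γ] at h₃
  simp only [hr']
  exact h₃

/-- If no geodesic between consecutive terms of a sequence passes through `y`, then all terms of
the sequence lie in the same direction from `y`. -/
lemma exists_common_neighbor {Y : GTree G} (y : Y.V) (z : ℕ → Y.V)
    (hz : ∀ n, Y.graph.dist (z n) y + Y.graph.dist y (z (n + 1)) ≠ Y.graph.dist (z n) (z (n + 1))) :
    ∃ w, Y.graph.Adj y w ∧ ∀ n, Y.graph.dist y w + Y.graph.dist w (z n) = Y.graph.dist y (z n) := by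
  have tri := fun a b c => Y.isTree.connected.dist_triangle (u := a) (v := b) (w := c)
  have step : ∀ n, ∃ w, Y.graph.dist y w = 1 ∧
      Y.graph.dist y w + Y.graph.dist w (z n) = Y.graph.dist y (z n) ∧
      Y.graph.dist y w + Y.graph.dist w (z (n + 1)) = Y.graph.dist y (z (n + 1)) := by
    intro n
    obtain ⟨m, h₁, h₂, h₃⟩ := Y.isTree.exists_median y (z n) (z (n + 1))
    have hm : 1 ≤ Y.graph.dist y m := by
      by_contra! h
      obtain rfl : y = m := Y.isTree.connected.dist_eq_zero_iff.1 (by omega)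
      exact hz n h₃
    obtain ⟨w, hw, hw'⟩ := Y.isTree.connected.exists_dist_eq y m hm
    have := tri y w (z n)
    have := tri y w (z (n + 1))
    have := tri w m (z n)
    have := tri w m (z (n + 1))
    exact ⟨w, hw, by omega, by omega⟩
  obtain ⟨w, hw, hw₀, -⟩ := step 0
  refine ⟨w, SimpleGraph.dist_eq_one_iff_adj.1 hw, fun n => ?_⟩
  induction n with
  | zero => exact hw₀
  | succ n ih =>
    obtain ⟨w', e, h₁, h₂⟩ := step n
    obtain rfl := Y.isTree.eq_of_dist_eq ih h₁ (by omega)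
    exact h₂

/-- Pigeonhole for a sequence of edges in a cocompact tree: among infinitely many of its indices,
two give edges in the same orbit whose images under an equivariant map to `Y` pass through `y` at
the same position. -/
lemma exists_translate_fixing {Y : GTree G} (hX : X.Cocompact) {f : X.V → Y.V}
    (hf : ∀ γ x, f (X.smul γ x) = Y.smul γ (f x)) {x : ℕ → X.V}
    (hx : ∀ n, X.graph.Adj (x n) (x (n + 1))) (y : Y.V)
    (hinf : {n | Y.graph.dist (f (x n)) y + Y.graph.dist y (f (x (n + 1))) =
      Y.graph.dist (f (x n)) (f (x (n + 1)))}.Infinite) :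
    ∃ n m, n < m ∧ ∃ γ, X.smul γ (x n) = x m ∧ Y.smul γ y = y := by
  obtain ⟨-, hfin⟩ := hX
  let r : X.Edge → X.Edge → Prop := fun e f => ∃ γ, edgeSmul γ e = f
  have hr : Equivalence r :=
    { refl := fun e => ⟨1, Subtype.ext (Prod.ext (X.smul_one _) (X.smul_one _))⟩
      symm := by
        rintro e _ ⟨γ, rfl⟩
        exact ⟨γ⁻¹, Subtype.ext (Prod.ext (X.smul_inv_smul _ _) (X.smul_inv_smul _ _))⟩
      trans := by
        rintro e _ _ ⟨γ, rfl⟩ ⟨δ, rfl⟩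
        exact ⟨δ * γ, Subtype.ext (Prod.ext (X.smul_mul _ _ _) (X.smul_mul _ _ _))⟩ }
  have : Finite (Quot r) := hfin
  let L : Quot r → ℕ := Quot.lift (fun e => Y.graph.dist (f (d0 e)) (f (d1 e))) (by
    rintro e _ ⟨γ, rfl⟩
    simp only [d0, d1, edgeSmul, hf, Y.dist_smul])
  obtain ⟨B, hB⟩ := (Set.finite_range L).bddAbove
  let e : ℕ → X.Edge := fun n => ⟨(x n, x (n + 1)), hx n⟩
  let F : ℕ → Quot r × ℕ := fun n => (Quot.mk r (e n), Y.graph.dist (f (x n)) y)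
  have hmaps : Set.MapsTo F {n | Y.graph.dist (f (x n)) y + Y.graph.dist y (f (x (n + 1))) =
      Y.graph.dist (f (x n)) (f (x (n + 1)))} (Set.univ ×ˢ Set.Iic B) := by
    rintro n (hn : _ = _)
    have : L (Quot.mk r (e n)) ≤ B := hB (Set.mem_range_self (f := L) (Quot.mk r (e n)))
    have : Y.graph.dist (f (x n)) (f (x (n + 1))) ≤ B := this
    exact ⟨trivial, show Y.graph.dist (f (x n)) y ≤ B by omega⟩
  obtain ⟨n, hn, m, hm, hnm, he⟩ := hinf.exists_lt_map_eq_of_mapsTo hmaps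
    (Set.finite_univ.prod (Set.finite_Iic B))
  obtain ⟨he₁, he₂⟩ := Prod.mk.inj he
  obtain ⟨γ, hγ⟩ := (hr.quot_mk_eq_iff _ _).1 he₁
  obtain ⟨h₁, h₂⟩ := Prod.mk.inj (congrArg Subtype.val hγ)
  change X.smul γ (x n) = x m at h₁
  change X.smul γ (x (n + 1)) = x (m + 1) at h₂
  refine ⟨n, m, hnm, γ, h₁, ?_⟩
  have e₁ := Y.dist_smul γ (f (x n)) y
  have e₂ := Y.dist_smul γ y (f (x (n + 1)))
  have e₃ := Y.dist_smul γ (f (x n)) (f (x (n + 1)))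
  rw [← hf, h₁] at e₁ e₃
  rw [← hf, h₂] at e₂ e₃
  simp only [Set.mem_ofPred_eq] at hn hm
  exact Y.isTree.eq_of_dist_eq (x := f (x m)) (y := f (x (m + 1))) (by omega) hm (by omega)

end GTree

open GTree in
/-- Proposition 6.3: let `X` and `Y` be cocompact `G`-trees which define the
same partition of `G` into elliptic and hyperbolic elements.  Suppose that `Y`
is proper and that every vertex stabilizer of `X` fixes a vertex of `Y`.  Then
`X` and `Y` have the same elliptic subgroups. -/
theorem sameEllipticSubgroups_of_proper {G : Type u} [Group G] (X Y : GTree G)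
    (hXc : X.Cocompact) (hYc : Y.Cocompact)
    (hpart : ∀ γ : G, X.Elliptic γ ↔ Y.Elliptic γ)
    (hYp : Y.Proper)
    (hstab : ∀ x : X.V, ∃ y : Y.V, ∀ γ : G, X.smul γ x = x → Y.smul γ y = y) :
    X.SameEllipticSubgroups Y := by
  obtain ⟨f, hf⟩ := exists_equivariant X Y hstab
  refine fun H => ⟨fun ⟨x, hx⟩ => ⟨f x, fun γ hγ => by rw [← hf, hx γ hγ]⟩, fun ⟨y, hy⟩ => ?_⟩
  suffices h : X.FixesVertex (Y.stab y) from h.imp fun x hx γ hγ => hx γ (hy γ hγ)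
  by_contra hfix
  obtain ⟨x, hdist, hx⟩ :=
    exists_fixed_ray (Y.stab y) (fun h hh => (hpart h).2 ⟨y, hh⟩) hfix
  have hadj : ∀ n, X.graph.Adj (x n) (x (n + 1)) := fun n =>
    SimpleGraph.dist_eq_one_iff_adj.1 (by rw [hdist _ _ n.le_succ]; omega)
  by_cases hinf : {n | Y.graph.dist (f (x n)) y + Y.graph.dist y (f (x (n + 1))) =
      Y.graph.dist (f (x n)) (f (x (n + 1)))}.Infinite
  · obtain ⟨n, m, hnm, γ, hγ, hγy⟩ := exists_translate_fixing hXc hf hadj y hinf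
    obtain ⟨N, hN⟩ := hx γ hγy
    have h := X.dist_smul γ (x n) (x (max N m))
    rw [hγ, hN _ (le_max_left _ _), hdist _ _ (le_max_right _ _),
      hdist _ _ (hnm.le.trans (le_max_right _ _))] at h
    have := le_max_right N m
    omega
  · obtain ⟨N, hN⟩ := (Set.not_infinite.1 hinf).bddAbove
    obtain ⟨w, hyw, hw⟩ := exists_common_neighbor y (fun n => f (x (N + 1 + n))) fun n hn => by
      have : N + 1 + n ≤ N := hN hn
      omega
    refine (hYp ⟨(y, w), hyw⟩).not_ge fun h hh => ⟨hh, ?_⟩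
    obtain ⟨M, hM⟩ := hx h hh
    refine smul_eq_of_dist_add_dist (q := f (x (N + 1 + M))) hh ?_ (hw M)
    rw [← hf, hM _ (by omega)]
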